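/- Let τ and τ' be permutations of the vectors of F^r fixing 0, with τ not a linear map (so SQS_τ is non-affine). If π is a permutation of the 2^{r+1} points with π(SQS_τ) = SQS_{τ'}, then there exist a, b ∈ F^r, A, B ∈ GL(r,2) and t ∈ {0,1} such that π = (σ_{a,A} | σ_{b,B})·ξ^t, where τ' = σ_B ∘ τ ∘ σ_{A^{-1}} if t = 0, and τ' = σ_B ∘ τ^{-1} ∘ σ_{A^{-1}} if t = 1. -/

import Mathlib

open Finset

/-- `V r` is the vector space `F^r` over `F = GF(2)`. -/
abbrev V (r : ℕ) : Type := Fin r → ZMod 2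

/-- The point set of `SQS_τ` (and the coordinate set of codes of length `2^{r+1}`):
left-half points `({a},∅)` are `Sum.inl a`, right-half points `(∅,{a})` are `Sum.inr a`. -/
abbrev Pt (r : ℕ) : Type := V r ⊕ V r

/-- Action of a coordinate permutation `π` on a word: `π(y)_i = y_{π⁻¹(i)}`. -/
def permAct {ι : Type} (π : Equiv.Perm ι) (y : ι → ZMod 2) : ι → ZMod 2 :=
  fun i => y (π.symm i)

/-- The extended Hamming code of length `2^r`, with coordinates indexed by the vectors
of `F^r`: all even weight words whose support sums to zero. -/
def extHamming (r : ℕ) : Set (V r → ZMod 2) :=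
  {x | ∑ a : V r, x a • a = 0 ∧ ∑ a : V r, x a = 0}

/-- `e_a` : the weight-one word with support `{a}`. -/
def unitVec {r : ℕ} (a : V r) : V r → ZMod 2 :=
  fun b => if b = a then 1 else 0

/-- The code `S_τ = ⋃_{a ∈ F^r} (H + e_a + e_0) × (H + e_{τ(a)} + e_0)` of length `2^{r+1}`. -/
def Scode {r : ℕ} (τ : Equiv.Perm (V r)) : Set (Pt r → ZMod 2) :=
  ⋃ a : V r, {z | ∃ h₁ ∈ extHamming r, ∃ h₂ ∈ extHamming r,
    z = Sum.elim (h₁ + unitVec a + unitVec 0) (h₂ + unitVec (τ a) + unitVec 0)}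

/-- `Q_0` : quadruples `({a,b,c,d},∅)`, `a,b,c,d` pairwise distinct, `a+b+c+d=0`. -/
def Q0 (r : ℕ) : Set (Finset (Pt r)) :=
  {q | ∃ a b c d : V r, a ≠ b ∧ a ≠ c ∧ a ≠ d ∧ b ≠ c ∧ b ≠ d ∧ c ≠ d ∧
    a + b + c + d = 0 ∧ q = {Sum.inl a, Sum.inl b, Sum.inl c, Sum.inl d}}

/-- `Q_1` : quadruples `(∅,{a,b,c,d})`, `a,b,c,d` pairwise distinct, `a+b+c+d=0`. -/
def Q1 (r : ℕ) : Set (Finset (Pt r)) :=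
  {q | ∃ a b c d : V r, a ≠ b ∧ a ≠ c ∧ a ≠ d ∧ b ≠ c ∧ b ≠ d ∧ c ≠ d ∧
    a + b + c + d = 0 ∧ q = {Sum.inr a, Sum.inr b, Sum.inr c, Sum.inr d}}

/-- `Q_τ` : quadruples `({a,c},{b,d})` with `τ(a+c) = b+d ≠ 0`. -/
def Qt {r : ℕ} (τ : Equiv.Perm (V r)) : Set (Finset (Pt r)) :=
  {q | ∃ a b c d : V r, τ (a + c) = b + d ∧ b + d ≠ 0 ∧
    q = {Sum.inl a, Sum.inl c, Sum.inr b, Sum.inr d}}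

/-- The Steiner quadruple system `SQS_τ = Q_0 ∪ Q_1 ∪ Q_τ`. -/
def SQS {r : ℕ} (τ : Equiv.Perm (V r)) : Set (Finset (Pt r)) :=
  Q0 r ∪ Q1 r ∪ Qt τ

/-- Action of a point bijection on a set system. -/
def qAct {α β : Type} [DecidableEq β] (π : α ≃ β) (Q : Set (Finset α)) : Set (Finset β) :=
  (fun q => q.image π) '' Q

/-- All quadruples of the system `Q` containing both points `p` and `p'`. -/
def quadsThrough {r : ℕ} (Q : Set (Finset (Pt r))) (p p' : Pt r) : Set (Finset (Pt r)) :=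
  {q ∈ Q | p ∈ q ∧ p' ∈ q}

/-- The affine permutation `σ_{a,A} : b ↦ a + A b` of `F^r`, where `A ∈ GL(r,2)`. -/
def affEquiv {r : ℕ} (a : V r) (A : V r ≃ₗ[ZMod 2] V r) : Equiv.Perm (V r) :=
  A.toEquiv.trans (Equiv.addLeft a)

/-- The permutation `ξ` swapping `({a},∅)` with `(∅,{a})` for every `a`. -/
def xi (r : ℕ) : Equiv.Perm (Pt r) := Equiv.sumComm (V r) (V r)

/-- Point transitivity of the Steiner quadruple system `SQS_τ`. -/
def SQSPointTransitive {r : ℕ} (τ : Equiv.Perm (V r)) : Prop :=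
  ∀ p p' : Pt r, ∃ π : Equiv.Perm (Pt r), qAct π (SQS τ) = SQS τ ∧ π p = p'

/-- A code is transitive if (a subgroup of) its automorphism group acts transitively
on its codewords: any codeword is mapped to any other by an automorphism `y ↦ x + π(y)`. -/
def IsTransitiveCode {ι : Type} (C : Set (ι → ZMod 2)) : Prop :=
  ∀ c ∈ C, ∀ c' ∈ C, ∃ (x : ι → ZMod 2) (π : Equiv.Perm ι),
    (fun y => x + permAct π y) '' C = C ∧ x + permAct π c = c'

/-- A code is coordinate transitive if `PAut(C)` acts transitively on coordinates. -/
def CoordTransitive {ι : Type} (C : Set (ι → ZMod 2)) : Prop :=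
  ∀ i j : ι, ∃ π : Equiv.Perm ι, permAct π '' C = C ∧ π i = j

/-- `C_1` : the words at Hamming distance exactly 1 from the code `C`. -/
def codeNbrs {ι : Type} [Fintype ι] (C : Set (ι → ZMod 2)) : Set (ι → ZMod 2) :=
  {y | y ∉ C ∧ ∃ c ∈ C, hammingDist y c = 1}

/-- A code is neighbor transitive if `Aut(C)` acts transitively both on `C` and on `C_1`. -/
def NeighborTransitive {ι : Type} [Fintype ι] (C : Set (ι → ZMod 2)) : Prop :=
  IsTransitiveCode C ∧
  ∀ y ∈ codeNbrs C, ∀ y' ∈ codeNbrs C, ∃ (x : ι → ZMod 2) (π : Equiv.Perm ι),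
    (fun w => x + permAct π w) '' C = C ∧ x + permAct π y = y'

/-- An extended perfect code: minimum distance 4 and `2^n/(2n)` codewords. -/
def IsExtPerfect {ι : Type} [Fintype ι] (C : Set (ι → ZMod 2)) : Prop :=
  (∀ x ∈ C, ∀ y ∈ C, x ≠ y → 4 ≤ hammingDist x y) ∧
  (∃ x ∈ C, ∃ y ∈ C, hammingDist x y = 4) ∧
  Nat.card C * (2 * Fintype.card ι) = 2 ^ Fintype.card ι

/-- The (extended) Mollard code `M(C,D)` with function `φ`. -/
def mollard {t m : ℕ} (C : Set (Fin t → ZMod 2)) (D : Set (Fin m → ZMod 2))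
    (φ : (Fin t → ZMod 2) → (Fin m → ZMod 2)) : Set (Fin t × Fin m → ZMod 2) :=
  {z | (fun i => ∑ j, z (i, j)) ∈ C ∧
       ∃ d ∈ D, (fun j => ∑ i, z (i, j)) = φ (fun i => ∑ j, z (i, j)) + d}

/-- Isomorphism of codes over possibly different coordinate sets:
`D = x + π(C)` for a coordinate bijection `π` and a vector `x`. -/
def CodeIso {ι κ : Type} (C : Set (ι → ZMod 2)) (D : Set (κ → ZMod 2)) : Prop :=
  ∃ (e : ι ≃ κ) (x : κ → ZMod 2), (fun z => x + fun k => z (e.symm k)) '' C = D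

/-- The rank of a code: the dimension of its linear span. -/
noncomputable def codeRank {ι : Type} (C : Set (ι → ZMod 2)) : ℕ :=
  Module.finrank (ZMod 2) ↥(Submodule.span (ZMod 2) C)

/-- The kernel of a code: `{x : x + C = C}`. -/
def codeKernel {ι : Type} (C : Set (ι → ZMod 2)) : Set (ι → ZMod 2) :=
  {x | (fun y => x + y) '' C = C}

/-- The dimension of the kernel of a code. -/
noncomputable def kernelDim {ι : Type} (C : Set (ι → ZMod 2)) : ℕ :=
  codeRank (codeKernel C)

/-- A permutation of `F^r` is affine if it is of the form `b ↦ a + A b`, `A ∈ GL(r,2)`. -/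
def IsAffinePerm {r : ℕ} (g : Equiv.Perm (V r)) : Prop :=
  ∃ (a : V r) (A : V r ≃ₗ[ZMod 2] V r), ∀ x, g x = a + A x

/-- A regular subgroup of `GA(r,2)`: a subgroup consisting of affine permutations that
acts sharply transitively on `F^r`. -/
def IsRegularAffineSubgroup {r : ℕ} (G : Subgroup (Equiv.Perm (V r))) : Prop :=
  (∀ g ∈ G, IsAffinePerm g) ∧ ∀ u v : V r, ∃! g : G, (g : Equiv.Perm (V r)) u = v

/-- `τ` is induced by an automorphism `T` of a regular subgroup `G ≤ GA(r,2)`: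
`T(g_a) = g_{τ(a)}`, i.e. `τ(g(0)) = (T g)(0)` for every `g ∈ G`. -/
def InducedByRegularAut {r : ℕ} (τ : Equiv.Perm (V r)) : Prop :=
  ∃ G : Subgroup (Equiv.Perm (V r)), IsRegularAffineSubgroup G ∧
    ∃ T : G ≃* G, ∀ g : G, τ ((g : Equiv.Perm (V r)) 0) = (T g : Equiv.Perm (V r)) 0

/-- The identification `F^{r+r'} ≃ F^r × F^{r'}`, `x|y ↦ (x,y)`. -/
def splitEquiv (r r' : ℕ) : V (r + r') ≃ V r × V r' :=
  (finSumFinEquiv.symm.arrowCongr (Equiv.refl (ZMod 2))).trans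
    (Equiv.sumArrowEquivProdArrow _ _ _)

/-- The concatenation `τ|τ'` of permutations: `(τ|τ')(x|y) = τ(x)|τ'(y)`. -/
def concatPerm {r r' : ℕ} (τ : Equiv.Perm (V r)) (τ' : Equiv.Perm (V r')) :
    Equiv.Perm (V (r + r')) :=
  (splitEquiv r r').trans ((τ.prodCongr τ').trans (splitEquiv r r').symm)


/-- Fourth point of the quadruple through three points. -/
def fourth {r : ℕ} (τ : Equiv.Perm (V r)) : Pt r → Pt r → Pt r → Pt r
  | .inl a, .inl b, .inl c => .inl (a + b + c)
  | .inr a, .inr b, .inr c => .inr (a + b + c)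
  | .inl a, .inl b, .inr c => .inr (c + τ (a + b))
  | .inl a, .inr c, .inl b => .inr (c + τ (a + b))
  | .inr c, .inl a, .inl b => .inr (c + τ (a + b))
  | .inr a, .inr b, .inl c => .inl (c + τ.symm (a + b))
  | .inr a, .inl c, .inr b => .inl (c + τ.symm (a + b))
  | .inl c, .inr a, .inr b => .inl (c + τ.symm (a + b))

/-- Which half a point lies in. -/
def col {r : ℕ} : Pt r → ZMod 2
  | .inl _ => 0
  | .inr _ => 1

lemma vadd_self {r : ℕ} (x : V r) : x + x = 0 := by
  funext i; exact CharTwo.add_self_eq_zero (x i)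

lemma vadd_eq_zero {r : ℕ} {x y : V r} : x + y = 0 ↔ x = y := by
  constructor
  · intro h
    have : x + y + y = y := by rw [h, zero_add]
    rwa [add_assoc, vadd_self, add_zero] at this
  · rintro rfl; exact vadd_self x

lemma vadd_cancel {r : ℕ} (x y : V r) : x + (x + y) = y := by
  rw [← add_assoc, vadd_self, zero_add]

lemma vadd_cancel' {r : ℕ} (x y : V r) : x + y + y = x := by
  rw [add_assoc, vadd_self, add_zero]

lemma vadd_cancel'' {r : ℕ} (x y : V r) : x + y + x = y := by
  rw [add_comm, vadd_cancel]

lemma symm_zero {r : ℕ} {τ : Equiv.Perm (V r)} (h0 : τ 0 = 0) : τ.symm 0 = 0 := by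
  rw [Equiv.symm_apply_eq, h0]

lemma fourth_swap12 {r : ℕ} (τ : Equiv.Perm (V r)) (p q s : Pt r) :
    fourth τ p q s = fourth τ q p s := by
  rcases p with p | p <;> rcases q with q | q <;> rcases s with s | s <;>
    simp [fourth, add_comm]

lemma fourth_swap23 {r : ℕ} (τ : Equiv.Perm (V r)) (p q s : Pt r) :
    fourth τ p q s = fourth τ p s q := by
  rcases p with p | p <;> rcases q with q | q <;> rcases s with s | s <;>
    simp [fourth, add_comm, add_left_comm]

lemma fourth_self {r : ℕ} {τ : Equiv.Perm (V r)} (h0 : τ 0 = 0) (p s : Pt r) :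
    fourth τ p p s = s := by
  rcases p with p | p <;> rcases s with s | s <;>
    simp [fourth, vadd_self, h0, symm_zero h0]

lemma fourth_ne {r : ℕ} {τ : Equiv.Perm (V r)} (h0 : τ 0 = 0) {p q s : Pt r}
    (hpq : p ≠ q) : fourth τ p q s ≠ s := by
  have h1 : ∀ x, τ x = 0 → x = 0 := fun x hx => τ.injective (hx.trans h0.symm)
  have h2 : ∀ x, τ.symm x = 0 → x = 0 := fun x hx =>
    τ.symm.injective (hx.trans (symm_zero h0).symm)
  rcases p with p | p <;> rcases q with q | q <;> rcases s with s | s <;>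
    simp [fourth] <;> intro h <;> apply hpq <;>
    simp only [Sum.inl.injEq, Sum.inr.injEq] <;> apply vadd_eq_zero.1
  all_goals first | exact h | exact h1 _ h | exact h2 _ h

lemma fourth_mem_SQS {r : ℕ} {τ : Equiv.Perm (V r)} (h0 : τ 0 = 0) {p q s : Pt r}
    (hpq : p ≠ q) (hps : p ≠ s) (hqs : q ≠ s) :
    ({p, q, s, fourth τ p q s} : Finset (Pt r)) ∈ SQS τ := by
  have n1 : fourth τ p q s ≠ s := fourth_ne h0 hpq
  have n2 : fourth τ p q s ≠ q := by rw [fourth_swap23]; exact fourth_ne h0 hps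
  have n3 : fourth τ p q s ≠ p := by
    rw [fourth_swap12, fourth_swap23]; exact fourth_ne h0 hqs
  have key : ∀ a b c : V r, a ≠ b →
      ({.inl a, .inl b, .inr c, .inr (c + τ (a + b))} : Finset (Pt r)) ∈ SQS τ := by
    intro a b c hab
    right
    refine ⟨a, c, b, c + τ (a + b), ?_, ?_, rfl⟩
    · rw [vadd_cancel]
    · rw [vadd_cancel]
      intro h
      exact hab (vadd_eq_zero.1 (τ.injective (h.trans h0.symm)))
  have key2 : ∀ a b c : V r, a ≠ b →
      ({.inl c, .inl (c + τ.symm (a + b)), .inr a, .inr b} : Finset (Pt r)) ∈ SQS τ := by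
    intro a b c hab
    right
    refine ⟨c, a, c + τ.symm (a + b), b, ?_, ?_, rfl⟩
    · rw [vadd_cancel]; simp
    · intro h
      exact hab (vadd_eq_zero.1 h)
  rcases p with p | p <;> rcases q with q | q <;> rcases s with s | s <;>
    simp only [fourth, ne_eq, Sum.inl.injEq, Sum.inr.injEq] at *
  · left; left
    exact ⟨p, q, s, p + q + s, hpq, hps, Ne.symm n3, hqs, Ne.symm n2, Ne.symm n1,
      vadd_self _, rfl⟩
  · exact key p q s hpq
  · convert key p s q hps using 1
    ext x; simp; tauto
  · convert key2 q s p hqs using 1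
    ext x; simp; tauto
  · convert key q s p hqs using 1
    ext x; simp; tauto
  · convert key2 p s q hps using 1
    ext x; simp; tauto
  · convert key2 p q s hpq using 1
    ext x; simp; tauto
  · left; right
    exact ⟨p, q, s, p + q + s, hpq, hps, Ne.symm n3, hqs, Ne.symm n2, Ne.symm n1,
      vadd_self _, rfl⟩

lemma fourth_mem_of_SQS {r : ℕ} {τ : Equiv.Perm (V r)} {p q s : Pt r}
    (hpq : p ≠ q) (hps : p ≠ s) (hqs : q ≠ s) {Q : Finset (Pt r)} (hQ : Q ∈ SQS τ)
    (hp : p ∈ Q) (hq : q ∈ Q) (hs : s ∈ Q) : fourth τ p q s ∈ Q := by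
  rcases hQ with (⟨a, b, c, d, -, -, -, -, -, -, h, rfl⟩ | ⟨a, b, c, d, -, -, -, -, -, -, h, rfl⟩) |
    ⟨a, b, c, d, h, -, rfl⟩
  · have hd : d = a + b + c := (vadd_eq_zero.1 h).symm
    subst hd
    simp only [Finset.mem_insert, Finset.mem_singleton] at hp hq hs ⊢
    rcases hp with rfl | rfl | rfl | rfl <;> rcases hq with rfl | rfl | rfl | rfl <;>
      first
      | exact absurd rfl hpq
      | (rcases hs with rfl | rfl | rfl | rfl <;>
          first
          | exact absurd rfl hps
          | exact absurd rfl hqs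
          | (simp only [fourth, Sum.inl.injEq]
             have ea := vadd_self a
             have eb := vadd_self b
             have ec := vadd_self c
             grind))
  · have hd : d = a + b + c := (vadd_eq_zero.1 h).symm
    subst hd
    simp only [Finset.mem_insert, Finset.mem_singleton] at hp hq hs ⊢
    rcases hp with rfl | rfl | rfl | rfl <;> rcases hq with rfl | rfl | rfl | rfl <;>
      first
      | exact absurd rfl hpq
      | (rcases hs with rfl | rfl | rfl | rfl <;>
          first
          | exact absurd rfl hps
          | exact absurd rfl hqs
          | (simp only [fourth, Sum.inr.injEq]
             have ea := vadd_self a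
             have eb := vadd_self b
             have ec := vadd_self c
             grind))
  · have h' : τ (c + a) = b + d := by rw [add_comm c a]; exact h
    have g : τ.symm (b + d) = a + c := by rw [← h]; simp
    have g' : τ.symm (d + b) = a + c := by rw [add_comm d b]; exact g
    have z1 := vadd_cancel a c
    have z2 := vadd_cancel b d
    have z3 : c + (a + c) = a := by rw [add_comm a c, vadd_cancel]
    have z4 : d + (b + d) = b := by rw [add_comm b d, vadd_cancel]
    simp only [Finset.mem_insert, Finset.mem_singleton] at hp hq hs ⊢
    rcases hp with rfl | rfl | rfl | rfl <;> rcases hq with rfl | rfl | rfl | rfl <;>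
      first
      | exact absurd rfl hpq
      | (rcases hs with rfl | rfl | rfl | rfl <;>
          first
          | exact absurd rfl hps
          | exact absurd rfl hqs
          | simp [fourth, h, h', g, g', z1, z2, z3, z4])

lemma map_fourth {r : ℕ} {τ τ' : Equiv.Perm (V r)} (h0 : τ 0 = 0) (h0' : τ' 0 = 0)
    {π : Equiv.Perm (Pt r)} (hπ : qAct π (SQS τ) = SQS τ') (p q s : Pt r) :
    π (fourth τ p q s) = fourth τ' (π p) (π q) (π s) := by
  by_cases hpq : p = q
  · subst hpq; rw [fourth_self h0, fourth_self h0']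
  by_cases hps : p = s
  · subst hps
    rw [fourth_swap23, fourth_self h0, fourth_swap23, fourth_self h0']
  by_cases hqs : q = s
  · subst hqs
    rw [fourth_swap12, fourth_swap23, fourth_self h0, fourth_swap12, fourth_swap23,
      fourth_self h0']
  have hpq' : π p ≠ π q := π.injective.ne hpq
  have hps' : π p ≠ π s := π.injective.ne hps
  have hqs' : π q ≠ π s := π.injective.ne hqs
  have hm : ({p, q, s, fourth τ p q s} : Finset (Pt r)).image π ∈ SQS τ' := by
    rw [← hπ]; exact ⟨_, fourth_mem_SQS h0 hpq hps hqs, rfl⟩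
  have h4 := fourth_mem_of_SQS hpq' hps' hqs' hm (by simp) (by simp) (by simp)
  have n1 : fourth τ' (π p) (π q) (π s) ≠ π s := fourth_ne h0' hpq'
  have n2 : fourth τ' (π p) (π q) (π s) ≠ π q := by
    rw [fourth_swap23]; exact fourth_ne h0' hps'
  have n3 : fourth τ' (π p) (π q) (π s) ≠ π p := by
    rw [fourth_swap12, fourth_swap23]; exact fourth_ne h0' hqs'
  simp only [Finset.image_insert, Finset.image_singleton, Finset.mem_insert,
    Finset.mem_singleton] at h4
  rcases h4 with h | h | h | h
  · exact absurd h n3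
  · exact absurd h n2
  · exact absurd h n1
  · exact h.symm

lemma col_fourth {r : ℕ} (τ : Equiv.Perm (V r)) (p q s : Pt r) :
    col (fourth τ p q s) = col p + col q + col s := by
  rcases p with p | p <;> rcases q with q | q <;> rcases s with s | s <;>
    simp [fourth, col] <;> decide

lemma fourth_transl {r : ℕ} (τ : Equiv.Perm (V r)) (p q p' s : Pt r)
    (h1 : col p = col q) (h2 : col p = col p') :
    fourth τ p' (fourth τ p q p') s = fourth τ p q s := by
  rcases p with p | p <;> rcases q with q | q <;> rcases p' with p' | p' <;>
    simp [col] at h1 h2 <;>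
  rcases s with s | s <;>
    simp [fourth, add_comm _ p', vadd_cancel]

lemma zmod2_cases (x y z : ZMod 2) : x = y ∨ x = z ∨ y = z := by
  revert x y z; decide

lemma col_const {r : ℕ} {τ τ' : Equiv.Perm (V r)} (h0 : τ 0 = 0)
    (hnl : ¬ ∀ x y : V r, τ (x + y) = τ x + τ y)
    {π : Equiv.Perm (Pt r)}
    (hT : ∀ p q s, π (fourth τ p q s) = fourth τ' (π p) (π q) (π s)) (x : V r) :
    col (π (.inl x)) = col (π (.inl 0)) := by
  by_contra hx
  apply hnl
  -- colour of a fourth point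
  have hc : ∀ p q s, col (π (fourth τ p q s)) = col (π p) + col (π q) + col (π s) := by
    intro p q s; rw [hT, col_fourth]
  have ht : ∀ p q p' s, col (π p) = col (π q) → col (π p) = col (π p') →
      fourth τ p' (fourth τ p q p') s = fourth τ p q s := by
    intro p q p' s h1 h2
    apply π.injective
    rw [hT, hT, hT, fourth_transl _ _ _ _ _ h1 h2]
  -- a right point with the colour of inl 0
  obtain ⟨y0, hy0⟩ : ∃ y0, col (π (.inl 0)) = col (π (.inr y0)) := by
    have h := hc (.inl 0) (.inl x) (.inr 0)
    simp only [fourth, zero_add] at h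
    have hne : col (π (.inr (τ x))) ≠ col (π (.inr 0)) := by
      rw [h]; revert hx
      generalize col (π (.inl x)) = u
      generalize col (π (.inl 0)) = v
      generalize col (π (.inr 0)) = w
      revert u v w; decide
    rcases zmod2_cases (col (π (.inl 0))) (col (π (.inr 0))) (col (π (.inr (τ x)))) with h | h | h
    · exact ⟨_, h⟩
    · exact ⟨_, h⟩
    · exact absurd h.symm hne
  have lin : ∀ h z, col (π (.inl h)) = col (π (.inl 0)) → τ (h + z) = τ h + τ z := by
    intro h z hh
    have e := ht (.inl 0) (.inr y0) (.inl h) (.inl z) hy0 hh.symm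
    simp only [fourth, zero_add, Sum.inr.injEq, add_assoc, add_right_inj] at e
    rw [← e, vadd_cancel]
  intro a b
  rcases zmod2_cases (col (π (.inl a))) (col (π (.inl b))) (col (π (.inl 0))) with h | h | h
  · have e := hc (.inl a) (.inl b) (.inl 0)
    simp only [fourth, add_zero] at e
    rw [h, CharTwo.add_self_eq_zero, zero_add] at e
    have := lin (a + b) b e
    rw [vadd_cancel'] at this
    rw [this, vadd_cancel']
  · exact lin a b h
  · rw [add_comm a, lin b a h, add_comm]

/-- A permutation preserving `a + b + c` is affine. -/
lemma affine_of_three {r : ℕ} (f : V r → V r) (hf : Function.Bijective f)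
    (h : ∀ a b c, f (a + b + c) = f a + f b + f c) :
    ∃ A : V r ≃ₗ[ZMod 2] V r, ∀ x, f x = f 0 + A x := by
  let g : V r →+ V r :=
    { toFun := fun x => f 0 + f x
      map_zero' := vadd_self _
      map_add' := by
        intro x y
        have := h x y 0
        rw [add_zero] at this
        rw [this]; abel_nf
        }
  have hg : Function.Bijective (g.toZModLinearMap 2) :=
    (Equiv.addLeft (f 0)).bijective.comp hf
  refine ⟨LinearEquiv.ofBijective (g.toZModLinearMap 2) hg, fun x => ?_⟩
  exact (vadd_cancel (f 0) (f x)).symm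

lemma iso_aux {r : ℕ} {τ τ' : Equiv.Perm (V r)}
    {π : Equiv.Perm (Pt r)}
    (hT : ∀ p q s, π (fourth τ p q s) = fourth τ' (π p) (π q) (π s))
    (hl : ∀ x, col (π (.inl x)) = 0) (hr : ∀ x, col (π (.inr x)) = 1) :
    ∃ (a b : V r) (A B : V r ≃ₗ[ZMod 2] V r),
      π = Equiv.sumCongr (affEquiv a A) (affEquiv b B) ∧
        τ' = A.symm.toEquiv.trans (τ.trans B.toEquiv) := by
  have hl' : ∀ x, ∃ y, π (.inl x) = .inl y := by
    intro x
    have := hl x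
    rcases h : π (.inl x) with y | y
    · exact ⟨y, rfl⟩
    · rw [h] at this; simp [col] at this
  have hr' : ∀ x, ∃ y, π (.inr x) = .inr y := by
    intro x
    have := hr x
    rcases h : π (.inr x) with y | y
    · rw [h] at this; simp [col] at this
    · exact ⟨y, rfl⟩
  choose f hf using hl'
  choose g hg using hr'
  have fi : Function.Injective f := by
    intro x y hxy
    have : π (.inl x) = π (.inl y) := by rw [hf, hf, hxy]
    simpa using this
  have gi : Function.Injective g := by
    intro x y hxy
    have : π (.inr x) = π (.inr y) := by rw [hg, hg, hxy]
    simpa using this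
  obtain ⟨A, hA⟩ := affine_of_three f (Finite.injective_iff_bijective.1 fi) (by
    intro a b c
    have := hT (.inl a) (.inl b) (.inl c)
    simpa [fourth, hf] using this)
  obtain ⟨B, hB⟩ := affine_of_three g (Finite.injective_iff_bijective.1 gi) (by
    intro a b c
    have := hT (.inr a) (.inr b) (.inr c)
    simpa [fourth, hg] using this)
  refine ⟨f 0, g 0, A, B, ?_, ?_⟩
  · ext x
    rcases x with x | x
    · rw [hf, hA]; rfl
    · rw [hg, hB]; rfl
  · ext1 x
    have := hT (.inl 0) (.inl (A.symm x)) (.inr 0)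
    simp only [fourth, hf, hg, Sum.inr.injEq, zero_add] at this
    rw [hB, hA (A.symm x), vadd_cancel, A.apply_symm_apply, add_right_inj] at this
    exact this.symm

lemma fourth_xi {r : ℕ} (τ : Equiv.Perm (V r)) (p q s : Pt r) :
    xi r (fourth τ.symm p q s) = fourth τ (xi r p) (xi r q) (xi r s) := by
  rcases p with p | p <;> rcases q with q | q <;> rcases s with s | s <;>
    simp [fourth, xi]

/-- if `τ` is not linear (so `SQS_τ` is non-affine) and a point
permutation `π` maps `SQS_τ` onto `SQS_{τ'}`, then `π = (σ_{a,A}|σ_{b,B})·ξ^t`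
with `τ' = BτA⁻¹` (when `t = 0`) or `τ' = Bτ⁻¹A⁻¹` (when `t = 1`). -/
theorem SQS_iso_necessity {r : ℕ} (τ τ' : Equiv.Perm (V r))
    (h0 : τ 0 = 0) (h0' : τ' 0 = 0)
    (hnl : ¬ ∀ x y : V r, τ (x + y) = τ x + τ y)
    (π : Equiv.Perm (Pt r)) (hπ : qAct π (SQS τ) = SQS τ') :
    ∃ (a b : V r) (A B : V r ≃ₗ[ZMod 2] V r),
      (π = Equiv.sumCongr (affEquiv a A) (affEquiv b B) ∧
        τ' = A.symm.toEquiv.trans (τ.trans B.toEquiv)) ∨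
      (π = (xi r).trans (Equiv.sumCongr (affEquiv a A) (affEquiv b B)) ∧
        τ' = A.symm.toEquiv.trans (τ.symm.trans B.toEquiv)) := by
  have hT := map_fourth h0 h0' hπ
  have hl := col_const h0 hnl hT
  have hr : ∀ y, col (π (.inr y)) = col (π (.inr 0)) := by
    intro y
    have h := congrArg col (hT (.inl 0) (.inl (τ.symm y)) (.inr 0))
    rw [col_fourth, hl (τ.symm y), CharTwo.add_self_eq_zero, zero_add] at h
    simpa [fourth] using h
  have hne : col (π (.inl 0)) ≠ col (π (.inr 0)) := by
    intro h
    have hall : ∀ p, col (π p) = col (π (.inl 0)) := by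
      rintro (p | p)
      · exact hl p
      · rw [hr p, h]
    have e1 := hall (π.symm (.inl 0))
    have e2 := hall (π.symm (.inr 0))
    rw [← e2] at e1
    simp [col] at e1
  have hd : ∀ u v : ZMod 2, u ≠ v → (u = 0 ∧ v = 1) ∨ (v = 0 ∧ u = 1) := by decide
  rcases hd _ _ hne with ⟨h1, h2⟩ | ⟨h1, h2⟩
  · obtain ⟨a, b, A, B, h⟩ := iso_aux hT (fun x => (hl x).trans h1) (fun x => (hr x).trans h2)
    exact ⟨a, b, A, B, Or.inl h⟩
  · obtain ⟨a, b, A, B, h, h'⟩ := iso_aux (τ := τ.symm) (τ' := τ') (π := (xi r).trans π)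
      (by intro p q s
          simp only [Equiv.trans_apply]
          rw [fourth_xi, hT])
      (fun x => (hr x).trans h1) (fun x => (hl x).trans h2)
    refine ⟨a, b, A, B, Or.inr ⟨?_, h'⟩⟩
    rw [← h]
    ext x
    rcases x with x | x <;> simp [xi]
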